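/- Let α ∈ {−1/d : d ∈ ℕ, d ≥ 3} ∪ [0,∞). There exist constants B > 1 and c_{α,1} > 0, depending only on α, such that for every q ∈ (0,1] and every shape exchangeable color-difference process (Δ(n))_{n≥1} with parameters (α, q), setting A := q^{−1/4}: liminf_{N→∞} μ( Δ₁(N) > 0 ∣ {τ_high(A) ≤ N} ∩ {τ_low(B) > N} ) ≥ 1 − c_{α,1}·√q, where μ(· ∣ E) denotes conditional probability given the event E. -/

import Mathlib

open MeasureTheory Filter
open scoped ENat

/-- Normalisation `Z_α(n) = 2α(1 - 1/n) + 1` for shape exchangeable trees. -/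
noncomputable def Zse (α : ℝ) (n : ℕ) : ℝ := 2 * α * (1 - 1 / (n : ℝ)) + 1

/-- `p(n, x₁, x₂) = (1/2)(1 + (x₁ + α x₂)/(Z_α(n) n))`, the probability that the new vertex
attaches to a red vertex. -/
noncomputable def pse (α : ℝ) (n : ℕ) (x₁ x₂ : ℤ) : ℝ :=
  (1 / 2) * (1 + ((x₁ : ℝ) + α * (x₂ : ℝ)) / (Zse α n * (n : ℝ)))

/-- The set of allowed parameters `α ∈ {-1/d : d ∈ ℕ, d ≥ 3} ∪ [0, ∞)` for
shape exchangeable trees. -/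
def seAllowed : Set ℝ := {x : ℝ | ∃ d : ℕ, 3 ≤ d ∧ x = -1 / (d : ℝ)} ∪ Set.Ici (0 : ℝ)

/-- A shape exchangeable (s.e.) color-difference process with parameters `(α, q)` on the
measurable space `Ω`: a probability measure `μ`, a filtration `F`, and an adapted `ℤ²`-valued
process `Δ` with `Δ(1) = (1,0)`, whose increments `D(n) = Δ(n+1) - Δ(n)` are
`F(n+1)`-measurable with values in `{(1,2), (-1,0), (1,0), (-1,-2)}`, and whose conditional
probabilities given `F n` (conditional expectations of indicator functions) are as prescribed. -/
structure SEProcess (α q : ℝ) (Ω : Type) [mΩ : MeasurableSpace Ω] where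
  μ : Measure Ω
  isProb : IsProbabilityMeasure μ
  F : ℕ → MeasurableSpace Ω
  F_le : ∀ n, F n ≤ mΩ
  F_mono : Monotone F
  Δ : ℕ → Ω → ℤ × ℤ
  adapted : ∀ n, 1 ≤ n → @Measurable Ω (ℤ × ℤ) (F n) _ (Δ n)
  init : ∀ ω, Δ 1 ω = (1, 0)
  D_meas : ∀ n, 1 ≤ n → @Measurable Ω (ℤ × ℤ) (F (n + 1)) _ (fun ω => Δ (n + 1) ω - Δ n ω)
  D_range : ∀ n, 1 ≤ n → ∀ ω,
    Δ (n + 1) ω - Δ n ω ∈ ({(1, 2), (-1, 0), (1, 0), (-1, -2)} : Set (ℤ × ℤ))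
  cond_rr : ∀ n, 1 ≤ n →
    μ[Set.indicator {ω | Δ (n + 1) ω - Δ n ω = (1, 2)} (fun _ => (1 : ℝ)) | F n]
      =ᵐ[μ] fun ω => pse α n (Δ n ω).1 (Δ n ω).2 * (1 - q)
  cond_br : ∀ n, 1 ≤ n →
    μ[Set.indicator {ω | Δ (n + 1) ω - Δ n ω = (-1, 0)} (fun _ => (1 : ℝ)) | F n]
      =ᵐ[μ] fun ω => pse α n (Δ n ω).1 (Δ n ω).2 * q
  cond_rb : ∀ n, 1 ≤ n →
    μ[Set.indicator {ω | Δ (n + 1) ω - Δ n ω = (1, 0)} (fun _ => (1 : ℝ)) | F n]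
      =ᵐ[μ] fun ω => (1 - pse α n (Δ n ω).1 (Δ n ω).2) * q
  cond_bb : ∀ n, 1 ≤ n →
    μ[Set.indicator {ω | Δ (n + 1) ω - Δ n ω = (-1, -2)} (fun _ => (1 : ℝ)) | F n]
      =ᵐ[μ] fun ω => (1 - pse α n (Δ n ω).1 (Δ n ω).2) * (1 - q)

/-- `τ_high(A) = inf {n ≥ 1 : Δ₁(n) + α Δ₂(n) > A Z_α(n) √n}`, with value `∞` if no such `n`
exists. -/
noncomputable def tauHigh {α q : ℝ} {Ω : Type} [MeasurableSpace Ω]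
    (P : SEProcess α q Ω) (A : ℝ) (ω : Ω) : ℕ∞ :=
  sInf {N : ℕ∞ | ∃ n : ℕ, N = (n : ℕ∞) ∧ 1 ≤ n ∧
    A * Zse α n * Real.sqrt n < ((P.Δ n ω).1 : ℝ) + α * ((P.Δ n ω).2 : ℝ)}

/-- `τ_low(B) = inf {n > τ_high(A) : Δ₁(n) + α Δ₂(n) ≤ B Z_α(n) √n}`, with value `∞` if no such
`n` exists. -/
noncomputable def tauLow {α q : ℝ} {Ω : Type} [MeasurableSpace Ω]
    (P : SEProcess α q Ω) (A B : ℝ) (ω : Ω) : ℕ∞ :=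
  sInf {N : ℕ∞ | ∃ n : ℕ, N = (n : ℕ∞) ∧ tauHigh P A ω < (n : ℕ∞) ∧
    ((P.Δ n ω).1 : ℝ) + α * ((P.Δ n ω).2 : ℝ) ≤ B * Zse α n * Real.sqrt n}


/-- Kolmogorov-type maximal inequality on an `F 0`-measurable set. -/
lemma kolm_aux {Ω : Type} [mΩ : MeasurableSpace Ω] (μ : Measure Ω) [IsProbabilityMeasure μ]
    (F : ℕ → MeasurableSpace Ω) (hle : ∀ n, F n ≤ mΩ) (hmono : Monotone F)
    (d : ℕ → Ω → ℝ) (c : ℕ → ℝ)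
    (hd : ∀ n, Measurable[F (n + 1)] (d n)) (hc : ∀ n ω, |d n ω| ≤ c n)
    (hz : ∀ n (f : Ω → ℝ), Measurable[F n] f → (∃ C, ∀ ω, |f ω| ≤ C) →
      ∫ ω, f ω * d n ω ∂μ = 0)
    (A : Set Ω) (hA : MeasurableSet[F 0] A) (ε : ℝ) (hε : 0 < ε) (N : ℕ) :
    ε ^ 2 * μ.real (A ∩ {ω | ∃ n, n ≤ N ∧ ε ≤ |∑ m ∈ Finset.range n, d m ω|}) ≤
      μ.real A * ∑ m ∈ Finset.range N, c m ^ 2 := by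
  classical
  let T : ℕ → Ω → ℝ := fun j => Nat.rec (fun _ => 0)
    (fun j t ω => t ω + if |t ω| < ε then d j ω else 0) j
  have T0 : ∀ ω, T 0 ω = 0 := fun ω => rfl
  have TS : ∀ j ω, T (j + 1) ω = T j ω + if |T j ω| < ε then d j ω else 0 := fun j ω => rfl
  have hTm : ∀ j, Measurable[F j] (T j) := by
    intro j
    induction j with
    | zero => exact measurable_const
    | succ j ih =>
      have ih' : Measurable[F (j + 1)] (T j) := ih.mono (hmono (Nat.le_succ j)) le_rfl
      have habs : Measurable[F (j + 1)] (fun ω => |T j ω|) := 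
        (measurable_norm (α := ℝ)).comp ih'
      exact ih'.add (Measurable.ite (habs measurableSet_Iio) (hd j) measurable_const)
  have hTb : ∀ j, ∃ C, ∀ ω, |T j ω| ≤ C := by
    intro j
    induction j with
    | zero => exact ⟨0, fun ω => by simp [T0]⟩
    | succ j ih =>
      obtain ⟨C, hC⟩ := ih
      refine ⟨C + |c j|, fun ω => ?_⟩
      rw [TS]
      refine (abs_add_le _ _).trans (add_le_add (hC ω) ?_)
      split_ifs
      · exact (hc j ω).trans (le_abs_self _)
      · simp
  have hint : ∀ f : Ω → ℝ, Measurable f → (∃ C, ∀ ω, |f ω| ≤ C) → Integrable f μ := by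
    rintro f hf ⟨C, hC⟩
    exact Integrable.of_bound hf.aestronglyMeasurable C (Eventually.of_forall hC)
  have hA' : MeasurableSet A := hle 0 A hA
  have hTm' : ∀ j, Measurable (T j) := fun j => (hTm j).mono (hle j) le_rfl
  have hdm' : ∀ j, Measurable (d j) := fun j => (hd j).mono (hle _) le_rfl
  have hTsq : ∀ j, Integrable (fun ω => T j ω ^ 2) μ := by
    intro j
    apply hint _ ((hTm' j).pow_const 2)
    obtain ⟨C, hC⟩ := hTb j
    refine ⟨C ^ 2, fun ω => ?_⟩
    rw [abs_pow]
    exact pow_le_pow_left₀ (abs_nonneg _) (hC ω) 2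
  have hE : ∀ j, ∫ ω in A, T j ω ^ 2 ∂μ ≤ μ.real A * ∑ m ∈ Finset.range j, c m ^ 2 := by
    intro j
    induction j with
    | zero => simp [T0]
    | succ j ih =>
      let f : Ω → ℝ := A.indicator (fun ω => 2 * if |T j ω| < ε then T j ω else 0)
      have hfm : Measurable[F j] f := by
        have habs : Measurable[F j] (fun ω => |T j ω|) := 
          (measurable_norm (α := ℝ)).comp (hTm j)
        refine Measurable.indicator ?_ (hmono (Nat.zero_le j) A hA)
        exact (Measurable.ite (habs measurableSet_Iio) (hTm j) measurable_const).const_mul 2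
      have hfb : ∃ C, ∀ ω, |f ω| ≤ C := by
        refine ⟨2 * ε, fun ω => ?_⟩
        by_cases hω : ω ∈ A
        · simp only [f, Set.indicator_of_mem hω, abs_mul]
          split_ifs with h
          · norm_num; linarith
          · simp; linarith
        · simp only [f, Set.indicator_of_notMem hω]; simp; linarith
      have h0 := hz j f hfm hfb
      have hfd : Integrable (fun ω => f ω * d j ω) μ := by
        obtain ⟨C, hC⟩ := hfb
        refine hint _ ((hfm.mono (hle j) le_rfl).mul (hdm' j)) ⟨C * c j, fun ω => ?_⟩
        rw [abs_mul]
        exact mul_le_mul (hC ω) (hc j ω) (abs_nonneg _) ((abs_nonneg _).trans (hC ω))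
      have hI1 : Integrable (fun ω => T j ω ^ 2 + f ω * d j ω) μ := (hTsq j).add hfd
      have hI2 : Integrable (fun ω => T j ω ^ 2 + f ω * d j ω + c j ^ 2) μ := 
        hI1.add (integrable_const _)
      have h1 : ∫ ω in A, T (j + 1) ω ^ 2 ∂μ ≤ 
          ∫ ω in A, (T j ω ^ 2 + f ω * d j ω + c j ^ 2) ∂μ := by
        refine setIntegral_mono_on (hTsq (j + 1)).integrableOn 
          hI2.integrableOn hA' ?_
        intro ω hω
        simp only [f, Set.indicator_of_mem hω, TS]
        have := sq_le_sq' (abs_le.mp (hc j ω)).1 (abs_le.mp (hc j ω)).2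
        split_ifs with h
        · nlinarith
        · nlinarith [sq_nonneg (c j)]
      have h2 : ∫ ω in A, f ω * d j ω ∂μ = 0 := by
        rw [← h0, ← integral_indicator hA']
        congr 1
        ext ω
        by_cases hω : ω ∈ A
        · simp [hω]
        · simp [f, hω]
      rw [integral_add hI1.integrableOn (integrable_const _).integrableOn,
        integral_add (hTsq j).integrableOn hfd.integrableOn, h2] at h1
      simp only [setIntegral_const, smul_eq_mul] at h1
      rw [Finset.sum_range_succ, mul_add]
      linarith
  have hS : ∀ j ω, |T j ω| < ε → T j ω = ∑ m ∈ Finset.range j, d m ω ∧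
      ∀ i ≤ j, |∑ m ∈ Finset.range i, d m ω| < ε := by
    intro j ω
    induction j with
    | zero => 
      intro h
      refine ⟨by simp [T0], fun i hi => ?_⟩
      obtain rfl : i = 0 := by omega
      simpa using hε
    | succ j ih =>
      intro h
      rw [TS] at h ⊢
      by_cases hj : |T j ω| < ε
      · rw [if_pos hj] at h ⊢
        obtain ⟨h1, h2⟩ := ih hj
        refine ⟨by rw [Finset.sum_range_succ, h1], fun i hi => ?_⟩
        rcases Nat.lt_or_ge i (j + 1) with h' | h'
        · exact h2 i (by omega)
        · obtain rfl : i = j + 1 := by omega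
          rw [Finset.sum_range_succ, ← h1]; exact h
      · rw [if_neg hj] at h
        simp at h; exact absurd h hj
  have hsub : A ∩ {ω | ∃ n, n ≤ N ∧ ε ≤ |∑ m ∈ Finset.range n, d m ω|} ⊆ 
      A ∩ {ω | ε ^ 2 ≤ T N ω ^ 2} := by
    rintro ω ⟨hω, n, hn, h⟩
    refine ⟨hω, ?_⟩
    by_contra hcon
    have : |T N ω| < ε := by
      have h3 : T N ω ^ 2 < ε ^ 2 := not_le.mp hcon
      exact abs_lt_of_sq_lt_sq h3 hε.le
    exact absurd h (not_le.mpr ((hS N ω this).2 n hn))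
  have hM := mul_meas_ge_le_integral_of_nonneg (μ := μ.restrict A) (f := fun ω => T N ω ^ 2)
    (Eventually.of_forall fun ω => sq_nonneg _) (hTsq N).integrableOn (ε ^ 2)
  have hmeas : MeasurableSet {ω | ε ^ 2 ≤ T N ω ^ 2} := 
    measurableSet_le measurable_const ((hTm' N).pow_const 2)
  rw [measureReal_restrict_apply hmeas] at hM
  refine le_trans ?_ (hM.trans (hE N))
  refine mul_le_mul_of_nonneg_left ?_ (sq_nonneg _)
  rw [Set.inter_comm _ A]
  exact measureReal_mono hsub

lemma se_bound (g : ℤ × ℤ → ℝ) (v : ℤ × ℤ) 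
    (hv : v ∈ ({(1, 2), (-1, 0), (1, 0), (-1, -2)} : Set (ℤ × ℤ))) (b : ℝ)
    (h1 : |g (1, 2)| ≤ b) (h2 : |g (-1, 0)| ≤ b) (h3 : |g (1, 0)| ≤ b) (h4 : |g (-1, -2)| ≤ b) : 
    |g v| ≤ b := by
  rcases hv with rfl | rfl | rfl | rfl <;> assumption

lemma int4_aux {Ω : Type} [mΩ : MeasurableSpace Ω] {μ : Measure Ω} {u1 u2 u3 u4 : Ω → ℝ}
    (i1 : Integrable u1 μ) (k1 : ∫ ω, u1 ω ∂μ = 0) (i2 : Integrable u2 μ) (k2 : ∫ ω, u2 ω ∂μ = 0)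
    (i3 : Integrable u3 μ) (k3 : ∫ ω, u3 ω ∂μ = 0) (i4 : Integrable u4 μ) (k4 : ∫ ω, u4 ω ∂μ = 0)
    (a b c d : ℝ) : ∫ ω, (u1 ω * a + u2 ω * b + u3 ω * c + u4 ω * d) ∂μ = 0 := by
  have h2 : Integrable (fun ω => u1 ω * a + u2 ω * b) μ := (i1.mul_const _).add (i2.mul_const _)
  have h3 : Integrable (fun ω => u1 ω * a + u2 ω * b + u3 ω * c) μ := h2.add (i3.mul_const _)
  rw [integral_add h3 (i4.mul_const _), integral_add h2 (i3.mul_const _), 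
    integral_add (i1.mul_const _) (i2.mul_const _)]
  simp [integral_mul_const, k1, k2, k3, k4]

lemma se_integral {α q : ℝ} {Ω : Type} [mΩ : MeasurableSpace Ω] (P : SEProcess α q Ω)
    (n : ℕ) (hn : 1 ≤ n) (g : ℤ × ℤ → ℝ) (f : Ω → ℝ) (hf : Measurable[P.F n] f)
    (hfb : ∃ C, ∀ ω, |f ω| ≤ C) (e : Ω → ℝ)
    (he : ∀ ω, e ω = (pse α n (P.Δ n ω).1 (P.Δ n ω).2 * (1 - q)) * g (1, 2) 
        + (pse α n (P.Δ n ω).1 (P.Δ n ω).2 * q) * g (-1, 0)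
        + ((1 - pse α n (P.Δ n ω).1 (P.Δ n ω).2) * q) * g (1, 0)
        + ((1 - pse α n (P.Δ n ω).1 (P.Δ n ω).2) * (1 - q)) * g (-1, -2)) :
    ∫ ω, f ω * (g (P.Δ (n + 1) ω - P.Δ n ω) - e ω) ∂P.μ = 0 := by
  have := P.isProb
  have key : ∀ (v : ℤ × ℤ) (r : Ω → ℝ), 
      P.μ[Set.indicator {ω | P.Δ (n + 1) ω - P.Δ n ω = v} (fun _ => (1 : ℝ)) | P.F n] =ᵐ[P.μ] r →
      Integrable (fun ω => f ω * (Set.indicator {ω | P.Δ (n + 1) ω - P.Δ n ω = v} (fun _ => (1 : ℝ)) ω 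
        - r ω)) P.μ ∧
      ∫ ω, f ω * (Set.indicator {ω | P.Δ (n + 1) ω - P.Δ n ω = v} (fun _ => (1 : ℝ)) ω 
        - r ω) ∂P.μ = 0 := by
    intro v r hr
    set I := Set.indicator {ω | P.Δ (n + 1) ω - P.Δ n ω = v} (fun _ => (1 : ℝ)) with hI
    have hms : MeasurableSet {ω | P.Δ (n + 1) ω - P.Δ n ω = v} := 
      ((P.D_meas n hn).mono (P.F_le _) le_rfl) (measurableSet_singleton v)
    have hIi : Integrable I P.μ := (integrable_const (1 : ℝ)).indicator hms
    have hri : Integrable r P.μ := integrable_condExp.congr hr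
    obtain ⟨C, hC⟩ := hfb
    have hfm : Measurable f := hf.mono (P.F_le n) le_rfl
    have hfI : Integrable (fun ω => f ω * I ω) P.μ :=
      hIi.bdd_mul hfm.aestronglyMeasurable (Eventually.of_forall hC)
    have hfr : Integrable (fun ω => f ω * r ω) P.μ :=
      hri.bdd_mul hfm.aestronglyMeasurable (Eventually.of_forall hC)
    have e1 : ∫ ω, f ω * I ω ∂P.μ = ∫ ω, f ω * r ω ∂P.μ := by
      rw [← integral_condExp (P.F_le n)]
      apply integral_congr_ae
      have := condExp_mul_of_stronglyMeasurable_left (m := P.F n) (μ := P.μ) (f := f) (g := I)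
        hf.stronglyMeasurable hfI hIi
      filter_upwards [this, hr] with ω h1 h2
      have h3 : (f * I) = fun ω => f ω * I ω := rfl
      rw [← h3, h1, Pi.mul_apply, h2]
    simp only [mul_sub]
    refine ⟨hfI.sub hfr, ?_⟩
    rw [integral_sub hfI hfr, e1, sub_self]
  obtain ⟨i1, k1⟩ := key _ _ (P.cond_rr n hn)
  obtain ⟨i2, k2⟩ := key _ _ (P.cond_br n hn)
  obtain ⟨i3, k3⟩ := key _ _ (P.cond_rb n hn)
  obtain ⟨i4, k4⟩ := key _ _ (P.cond_bb n hn)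
  have hpt : ∀ ω, f ω * (g (P.Δ (n + 1) ω - P.Δ n ω) - e ω) = 
      f ω * (Set.indicator {ω | P.Δ (n + 1) ω - P.Δ n ω = (1, 2)} (fun _ => (1 : ℝ)) ω 
        - pse α n (P.Δ n ω).1 (P.Δ n ω).2 * (1 - q)) * g (1, 2)
      + f ω * (Set.indicator {ω | P.Δ (n + 1) ω - P.Δ n ω = (-1, 0)} (fun _ => (1 : ℝ)) ω 
        - pse α n (P.Δ n ω).1 (P.Δ n ω).2 * q) * g (-1, 0)
      + f ω * (Set.indicator {ω | P.Δ (n + 1) ω - P.Δ n ω = (1, 0)} (fun _ => (1 : ℝ)) ω 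
        - (1 - pse α n (P.Δ n ω).1 (P.Δ n ω).2) * q) * g (1, 0)
      + f ω * (Set.indicator {ω | P.Δ (n + 1) ω - P.Δ n ω = (-1, -2)} (fun _ => (1 : ℝ)) ω 
        - (1 - pse α n (P.Δ n ω).1 (P.Δ n ω).2) * (1 - q)) * g (-1, -2) := by
    intro ω
    rw [he ω]
    have := P.D_range n hn ω
    simp only [Set.indicator_apply, Set.mem_ofPred_eq]
    simp only [Set.mem_insert_iff, Set.mem_singleton_iff] at this
    rcases this with h | h | h | h <;> simp only [h] <;> simp <;> ring
  simp only [hpt]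
  exact int4_aux i1 k1 i2 k2 i3 k3 i4 k4 _ _ _ _

lemma seAllowed_ge {α : ℝ} (hα : α ∈ seAllowed) : -(1 / 3) ≤ α := by
  rcases hα with ⟨d, hd, rfl⟩ | h
  · have : (3 : ℝ) ≤ d := by exact_mod_cast hd
    rw [neg_div, neg_le_neg_iff]
    exact one_div_le_one_div_of_le (by norm_num) this
  · have : (0 : ℝ) ≤ α := h
    linarith

noncomputable def seW (α : ℝ) (n : ℕ) : ℝ := Zse α n * n

noncomputable def seK (α q : ℝ) : ℝ := (1 + 2 * α) - q * (2 + 2 * α)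

noncomputable def seA (α q : ℝ) (n : ℕ) : ℝ := ∏ m ∈ Finset.range n, (1 + seK α q / seW α m)

lemma seW_eq (α : ℝ) (n : ℕ) (hn : 1 ≤ n) : seW α n = (1 + 2 * α) * n - 2 * α := by
  have : (n : ℝ) ≠ 0 := by positivity
  unfold seW Zse
  field_simp
  ring

lemma seW_zero (α : ℝ) : seW α 0 = 0 := by simp [seW]

lemma Zse_ge {α : ℝ} (h : -(1 / 3) ≤ α) (n : ℕ) (hn : 1 ≤ n) : 1 / 3 ≤ Zse α n := by
  have h1 : (1 : ℝ) ≤ n := by exact_mod_cast hn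
  have h2 : 1 / (n : ℝ) ≤ 1 := by rw [div_le_one (by linarith)]; exact h1
  have h3 : 0 ≤ 1 / (n : ℝ) := by positivity
  unfold Zse
  nlinarith

lemma Zse_le (α : ℝ) (n : ℕ) (hn : 1 ≤ n) : Zse α n ≤ 1 + 2 * |α| := by
  have h1 : (1 : ℝ) ≤ n := by exact_mod_cast hn
  have h2 : 1 / (n : ℝ) ≤ 1 := by rw [div_le_one (by linarith)]; exact h1
  have h3 : 0 ≤ 1 / (n : ℝ) := by positivity
  unfold Zse
  nlinarith [le_abs_self α, abs_nonneg α]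

lemma seW_ge {α : ℝ} (h : -(1 / 3) ≤ α) (n : ℕ) (hn : 1 ≤ n) : (n : ℝ) / 3 ≤ seW α n := by
  have := Zse_ge h n hn
  unfold seW
  have h1 : (1 : ℝ) ≤ n := by exact_mod_cast hn
  nlinarith

lemma seK_ge {α q : ℝ} (h : -(1 / 3) ≤ α) (hq : q ≤ 1 / 16) :
    3 / 4 * (1 + 2 * α) ≤ seK α q := by
  unfold seK
  nlinarith

lemma seK_pos {α q : ℝ} (h : -(1 / 3) ≤ α) (hq : q ≤ 1 / 16) : 0 < seK α q := by
  have := seK_ge h hq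
  linarith

lemma seK_le {α q : ℝ} (h : -(1 / 3) ≤ α) (hq : 0 < q) : seK α q ≤ 1 + 2 * α := by
  unfold seK
  nlinarith

lemma seA_succ (α q : ℝ) (n : ℕ) : seA α q (n + 1) = seA α q n * (1 + seK α q / seW α n) := by
  unfold seA
  rw [Finset.prod_range_succ]

lemma seA_one (α q : ℝ) : seA α q 1 = 1 := by
  simp [seA, seW_zero]

lemma seA_pos {α q : ℝ} (h : -(1 / 3) ≤ α) (hq : q ≤ 1 / 16) (n : ℕ) : 0 < seA α q n := by
  unfold seA
  apply Finset.prod_pos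
  intro m _
  have := seK_pos h hq
  have h2 : 0 ≤ seW α m := by
    rcases Nat.eq_zero_or_pos m with rfl | hm
    · simp [seW_zero]
    · have := seW_ge h m hm
      exact le_trans (by positivity) this
  positivity

lemma seA_ratio {α q : ℝ} (h : -(1 / 3) ≤ α) (hq : q ≤ 1 / 16) (n : ℕ) (hn : 1 ≤ n) :
    seA α q n ^ 2 * (n + 7 / 2) ≤ seA α q (n + 1) ^ 2 * (n + 2) := by
  have hn1 : (1 : ℝ) ≤ n := by exact_mod_cast hn
  have hW := seW_ge h n hn
  have hWpos : 0 < seW α n := by linarith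
  have hWle : seW α n ≤ (1 + 2 * α) * (n + 2) := by rw [seW_eq α n hn]; nlinarith
  have hK := seK_ge h hq
  have hr : 3 / 4 ≤ seK α q / seW α n * (n + 2) := by
    rw [div_mul_eq_mul_div, le_div_iff₀ hWpos]
    nlinarith
  rw [seA_succ, mul_pow, mul_assoc]
  apply mul_le_mul_of_nonneg_left _ (sq_nonneg _)
  have : 0 ≤ (seK α q / seW α n) ^ 2 * (n + 2) := by positivity
  nlinarith

lemma seU_step {α q : ℝ} (h : -(1 / 3) ≤ α) (hq : q ≤ 1 / 16) (n : ℕ) (hn : 1 ≤ n) :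
    ((n : ℝ) + 1 + 2) / seA α q (n + 1) ^ 2 + 1 / 2 * (1 / seA α q (n + 1) ^ 2)  
      ≤ (n + 2) / seA α q n ^ 2 := by
  have h1 := seA_ratio h hq n hn
  have hp := seA_pos h hq n
  have hp' := seA_pos h hq (n + 1)
  have : ((n : ℝ) + 1 + 2) / seA α q (n + 1) ^ 2 + 1 / 2 * (1 / seA α q (n + 1) ^ 2) = 
     (n + 7 / 2) / seA α q (n + 1) ^ 2 := by field_simp; ring
  rw [this, div_le_div_iff₀ (by positivity) (by positivity)]
  nlinarith

lemma seU_sum {α q : ℝ} (h : -(1 / 3) ≤ α) (hq : q ≤ 1 / 16) (k : ℕ) (hk : 1 ≤ k) (j : ℕ) :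
    ((k + j : ℕ) + 2 : ℝ) / seA α q (k + j) ^ 2 + 
      1 / 2 * ∑ m ∈ Finset.range j, 1 / seA α q (k + m + 1) ^ 2 ≤ (k + 2) / seA α q k ^ 2 := by
  induction j with
  | zero => simp
  | succ j ih =>
    have := seU_step h hq (k + j) (by omega)
    rw [Finset.sum_range_succ, ← add_assoc k j 1]
    push_cast at this ih ⊢
    linarith

lemma seA_sum_le {α q : ℝ} (h : -(1 / 3) ≤ α) (hq : q ≤ 1 / 16) (k : ℕ) (hk : 1 ≤ k) (j : ℕ) :
    ∑ m ∈ Finset.range j, 1 / seA α q (k + m + 1) ^ 2 ≤ 2 * ((k + 2) / seA α q k ^ 2) := by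
  have := seU_sum h hq k hk j
  have h2 : 0 ≤ ((k + j : ℕ) + 2 : ℝ) / seA α q (k + j) ^ 2 := by positivity
  linarith

lemma seA_mono {α q : ℝ} (h : -(1 / 3) ≤ α) (hq : q ≤ 1 / 16) (k n : ℕ) (hk : 1 ≤ k) (hn : k ≤ n) :
    seA α q k ^ 2 * n ≤ 3 * k * seA α q n ^ 2 := by
  obtain ⟨j, rfl⟩ := Nat.exists_eq_add_of_le hn
  have := seU_sum h hq k hk j
  have h2 : 0 ≤ ∑ m ∈ Finset.range j, 1 / seA α q (k + m + 1) ^ 2 := 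
    Finset.sum_nonneg fun m _ => by positivity
  have h3 : ((k + j : ℕ) + 2 : ℝ) / seA α q (k + j) ^ 2 ≤ (k + 2) / seA α q k ^ 2 := by linarith
  have hp := seA_pos h hq k
  have hp' := seA_pos h hq (k + j)
  rw [div_le_div_iff₀ (by positivity) (by positivity)] at h3
  have hk1 : (1 : ℝ) ≤ k := by exact_mod_cast hk
  have : 0 < seA α q (k + j) ^ 2 := by positivity
  have : 0 < seA α q k ^ 2 := by positivity
  nlinarith

lemma seA_four {α q : ℝ} (h : -(1 / 3) ≤ α) (hq : q ≤ 1 / 16) (n : ℕ) (hn : 1 ≤ n) :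
    ((n : ℝ) + 2) ^ 2 * (n + 3) ≤ 36 * (seA α q n ^ 2) ^ 2 := by
  induction n, hn using Nat.le_induction with
  | base => rw [seA_one]; norm_num
  | succ n hn ih =>
    have h1 := seA_ratio h hq n hn
    set x := seA α q n ^ 2
    set y := seA α q (n + 1) ^ 2
    have hx : 0 ≤ x := sq_nonneg _
    have hn0 : (0 : ℝ) ≤ n := Nat.cast_nonneg n
    have h2 : (x * (n + 7 / 2)) ^ 2 ≤ (y * (n + 2)) ^ 2 := pow_le_pow_left₀ (by positivity) h1 2
    push_cast
    have h3 : ((n : ℝ) + 2) ^ 2 * (n + 3) * (n + 7 / 2) ^ 2 ≤ 36 * x ^ 2 * (n + 7 / 2) ^ 2 :=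
      mul_le_mul_of_nonneg_right ih (sq_nonneg _)
    have h4 : ((n : ℝ) + 2) ^ 2 * ((n + 3) * (n + 7 / 2) ^ 2) ≤ (n + 2) ^ 2 * (36 * y ^ 2) := by
      nlinarith
    have h5 := le_of_mul_le_mul_left h4 (by positivity)
    refine le_trans ?_ h5
    nlinarith

lemma seA_large {α q : ℝ} (h : -(1 / 3) ≤ α) (hq : q ≤ 1 / 16) (R : ℝ) :
    ∀ᶠ n : ℕ in atTop, R * n ≤ seA α q n ^ 2 := by
  have : ∀ᶠ n : ℕ in atTop, 36 * R ^ 2 ≤ (n : ℝ) := 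
    tendsto_natCast_atTop_atTop.eventually_ge_atTop _
  filter_upwards [this, eventually_ge_atTop 1] with n h1 hn
  have h2 := seA_four h hq n hn
  have hn0 : (0 : ℝ) ≤ n := Nat.cast_nonneg n
  apply le_of_abs_le
  apply abs_le_of_sq_le_sq _ (sq_nonneg _)
  have h3 : R ^ 2 * 36 * (n + 2) ^ 2 ≤ (n + 3) * ((n : ℝ) + 2) ^ 2 :=
    mul_le_mul_of_nonneg_right (by linarith) (sq_nonneg _)
  have h4 : R ^ 2 * n ^ 2 ≤ R ^ 2 * ((n : ℝ) + 2) ^ 2 := by gcongr; linarith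
  nlinarith

section process

variable {α q : ℝ} {Ω : Type} [mΩ : MeasurableSpace Ω]

noncomputable def seX (P : SEProcess α q Ω) (n : ℕ) (ω : Ω) : ℝ :=
  ((P.Δ n ω).1 : ℝ) + α * ((P.Δ n ω).2 : ℝ)

noncomputable def seXi (P : SEProcess α q Ω) (n : ℕ) (ω : Ω) : ℝ :=
  seX P (n + 1) ω - seX P n ω - seK α q / seW α n * seX P n ω

noncomputable def seL (P : SEProcess α q Ω) (n : ℕ) (ω : Ω) : ℝ :=
  ((P.Δ n ω).1 : ℝ) - (1 - 2 * q) / seK α q * seX P n ω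

lemma seX_meas (P : SEProcess α q Ω) (n : ℕ) (hn : 1 ≤ n) : Measurable[P.F n] (seX P n) := by
  have hg : Measurable (fun v : ℤ × ℤ => (v.1 : ℝ) + α * (v.2 : ℝ)) := measurable_of_countable _
  exact hg.comp (P.adapted n hn)

lemma seL_meas (P : SEProcess α q Ω) (n : ℕ) (hn : 1 ≤ n) : Measurable[P.F n] (seL P n) := by
  have hg : Measurable (fun v : ℤ × ℤ => (v.1 : ℝ) 
    - (1 - 2 * q) / seK α q * ((v.1 : ℝ) + α * (v.2 : ℝ))) := measurable_of_countable _
  exact hg.comp (P.adapted n hn)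

lemma seX_one (P : SEProcess α q Ω) (ω : Ω) : seX P 1 ω = 1 := by
  simp [seX, P.init]

lemma seX_diff (P : SEProcess α q Ω) (n : ℕ) (ω : Ω) : seX P (n + 1) ω - seX P n ω = 
    (fun v : ℤ × ℤ => (v.1 : ℝ) + α * (v.2 : ℝ)) (P.Δ (n + 1) ω - P.Δ n ω) := by
  simp [seX]; ring

lemma seX_diff_abs (P : SEProcess α q Ω) (n : ℕ) (hn : 1 ≤ n) (ω : Ω) : 
    |seX P (n + 1) ω - seX P n ω| ≤ 1 + 2 * |α| := by
  rw [seX_diff]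
  have h0 := abs_nonneg α
  have h1 := le_abs_self α
  have h2 := neg_abs_le α
  apply se_bound (fun v : ℤ × ℤ => (v.1 : ℝ) + α * (v.2 : ℝ)) _ (P.D_range n hn ω) <;> simp only [abs_le] <;> push_cast <;> 
    constructor <;> linarith

lemma seX_abs (P : SEProcess α q Ω) (n : ℕ) (hn : 1 ≤ n) (ω : Ω) : 
    |seX P n ω| ≤ (1 + 2 * |α|) * n := by
  induction n, hn using Nat.le_induction with
  | base => rw [seX_one]; simp
  | succ n hn ih =>
    have h1 := seX_diff_abs P n hn ω
    have h2 := abs_add_le (seX P (n + 1) ω - seX P n ω) (seX P n ω)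
    rw [sub_add_cancel] at h2
    push_cast
    linarith

lemma seXi_abs (P : SEProcess α q Ω) (h : -(1 / 3) ≤ α) (hq0 : 0 < q) (hq : q ≤ 1 / 16) 
    (n : ℕ) (hn : 1 ≤ n) (ω : Ω) : |seXi P n ω| ≤ 4 * (1 + 2 * |α|) ^ 2 := by
  have h1 := seX_diff_abs P n hn ω
  have h2 := seX_abs P n hn ω
  have h3 := seW_ge h n hn
  have hn1 : (1 : ℝ) ≤ n := by exact_mod_cast hn
  have hK := seK_pos h hq
  have hK' := seK_le h hq0
  set m := 1 + 2 * |α| with hm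
  have hm1 : 1 ≤ m := by have := abs_nonneg α; linarith
  have hKm : seK α q ≤ m := by have := le_abs_self α; linarith
  have hWp : 0 < seW α n := by linarith
  have h4 : |seK α q / seW α n * seX P n ω| ≤ 3 * m ^ 2 := by
    rw [abs_mul, abs_of_nonneg (by positivity), div_mul_eq_mul_div, div_le_iff₀ hWp]
    have : seK α q * |seX P n ω| ≤ m * (m * n) := by gcongr
    have : m ^ 2 * n ≤ m ^ 2 * (3 * seW α n) := by gcongr; linarith
    nlinarith
  have := abs_sub (seX P (n + 1) ω - seX P n ω) (seK α q / seW α n * seX P n ω)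
  unfold seXi
  nlinarith

lemma pse_eq (P : SEProcess α q Ω) (n : ℕ) (ω : Ω) : 
    pse α n (P.Δ n ω).1 (P.Δ n ω).2 = 1 / 2 * (1 + seX P n ω / seW α n) := rfl

lemma seXi_int (P : SEProcess α q Ω) (n : ℕ) (hn : 1 ≤ n) (f : Ω → ℝ) (hf : Measurable[P.F n] f)
    (hfb : ∃ C, ∀ ω, |f ω| ≤ C) : ∫ ω, f ω * seXi P n ω ∂P.μ = 0 := by
  have := se_integral P n hn (fun v : ℤ × ℤ => (v.1 : ℝ) + α * (v.2 : ℝ)) f hf hfb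
    (fun ω => seK α q / seW α n * seX P n ω) (by
      intro ω
      rw [pse_eq]
      simp only [seK]
      push_cast
      ring)
  rw [← this]
  simp only [seXi, seX_diff]

lemma seL_int (P : SEProcess α q Ω) (hK : 0 < seK α q) (n : ℕ) (hn : 1 ≤ n) (f : Ω → ℝ) 
    (hf : Measurable[P.F n] f) (hfb : ∃ C, ∀ ω, |f ω| ≤ C) : 
    ∫ ω, f ω * (seL P (n + 1) ω - seL P n ω) ∂P.μ = 0 := by
  have := se_integral P n hn (fun v : ℤ × ℤ => (v.1 : ℝ) - (1 - 2 * q) / seK α q * 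
    ((v.1 : ℝ) + α * (v.2 : ℝ))) f hf hfb
    (fun ω => 0) (by
      intro ω
      rw [pse_eq]
      generalize hg : (1 - 2 * q) / seK α q = g
      have hg' : g * ((1 + 2 * α) - q * (2 + 2 * α)) = 1 - 2 * q := by
        rw [← hg]
        change _ * seK α q = _
        field_simp
      push_cast
      linear_combination (seX P n ω / seW α n) * hg')
  rw [← this]
  congr 1
  ext ω
  simp only [seL, seX, Prod.fst_sub, Prod.snd_sub]
  push_cast
  ring

lemma se_tele (P : SEProcess α q Ω) (h : -(1 / 3) ≤ α) (hq : q ≤ 1 / 16) (k j : ℕ) (ω : Ω) :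
    ∑ m ∈ Finset.range j, seXi P (k + m) ω / seA α q (k + m + 1) = 
      seX P (k + j) ω / seA α q (k + j) - seX P k ω / seA α q k := by
  induction j with
  | zero => simp
  | succ j ih =>
    rw [Finset.sum_range_succ, ih, ← add_assoc k j 1]
    have h1 := seA_pos h hq (k + j)
    have h2 := seA_pos h hq (k + j + 1)
    rw [seA_succ] at h2 ⊢
    have h3 : 1 + seK α q / seW α (k + j) ≠ 0 := right_ne_zero_of_mul h2.ne'
    generalize hr : seK α q / seW α (k + j) = r at *
    simp only [seXi, hr]
    field_simp
    ring

lemma se_dev (P : SEProcess α q Ω) (h : -(1 / 3) ≤ α) (hq0 : 0 < q) (hq : q ≤ 1 / 16) 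
    (k : ℕ) (hk : 1 ≤ k) (A : Set Ω) (hA : MeasurableSet[P.F k] A) (ε : ℝ) (hε : 0 < ε) (N : ℕ) :
    ε ^ 2 * P.μ.real (A ∩ {ω | ∃ n, n ≤ N ∧ 
      ε ≤ |seX P (k + n) ω / seA α q (k + n) - seX P k ω / seA α q k|}) ≤
      P.μ.real A * ((4 * (1 + 2 * |α|) ^ 2) ^ 2 * (2 * ((k + 2) / seA α q k ^ 2))) := by
  have := P.isProb
  have key := kolm_aux P.μ (fun j => P.F (k + j)) (fun j => P.F_le _) 
    (fun i j hij => P.F_mono (by omega)) (fun j ω => seXi P (k + j) ω / seA α q (k + j + 1))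
    (fun j => (4 * (1 + 2 * |α|) ^ 2) / seA α q (k + j + 1)) 
    (by
      intro n
      have h1 := seX_meas P (k + n + 1) (by omega)
      have h2 := (seX_meas P (k + n) (by omega)).mono (P.F_mono (Nat.le_succ _)) le_rfl
      exact ((h1.sub h2).sub (h2.const_mul _)).div_const _)
    (by
      intro n ω
      have h2 := seA_pos h hq (k + n + 1)
      rw [abs_div, abs_of_pos h2]
      gcongr
      exact seXi_abs P h hq0 hq _ (by omega) ω)
    (by
      intro n f hf hfb
      have := seXi_int P (k + n) (by omega) f hf hfb
      simp only [← mul_div_assoc]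
      rw [integral_div, this, zero_div])
    A hA ε hε N
  simp only [se_tele P h hq] at key
  refine key.trans ?_
  gcongr
  simp only [div_pow]
  have h3 := seA_sum_le h hq k hk N
  simp only [div_eq_mul_one_div ((4 * (1 + 2 * |α|) ^ 2) ^ 2), ← Finset.mul_sum]
  gcongr

lemma seL_dev (P : SEProcess α q Ω) (h : -(1 / 3) ≤ α) (hq0 : 0 < q) (hq : q ≤ 1 / 16) 
    (ε : ℝ) (hε : 0 < ε) (N : ℕ) :
    ε ^ 2 * P.μ.real {ω | ε ≤ |seL P (1 + N) ω - seL P 1 ω|} ≤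
      N * (1 + (1 - 2 * q) / seK α q * (1 + 2 * |α|)) ^ 2 := by
  have := P.isProb
  have hK := seK_pos h hq
  have hga : 0 ≤ (1 - 2 * q) / seK α q := div_nonneg (by linarith) hK.le
  have htel : ∀ n ω, ∑ m ∈ Finset.range n, (seL P (1 + m + 1) ω - seL P (1 + m) ω) = 
      seL P (1 + n) ω - seL P 1 ω := by
    intro n ω
    have := Finset.sum_range_sub (fun m => seL P (1 + m) ω) n
    exact this
  have key := kolm_aux P.μ (fun j => P.F (1 + j)) (fun j => P.F_le _) 
    (fun i j hij => P.F_mono (by omega)) (fun j ω => seL P (1 + j + 1) ω - seL P (1 + j) ω)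
    (fun j => (1 + (1 - 2 * q) / seK α q * (1 + 2 * |α|))) 
    (by
      intro n
      have h1 := seL_meas P (1 + n + 1) (by omega)
      have h2 := (seL_meas P (1 + n) (by omega)).mono (P.F_mono (Nat.le_succ _)) le_rfl
      exact h1.sub h2)
    (by
      intro n ω
      have h1 : seL P (1 + n + 1) ω - seL P (1 + n) ω = 
        (fun v : ℤ × ℤ => (v.1 : ℝ)) (P.Δ (1 + n + 1) ω - P.Δ (1 + n) ω) 
          - (1 - 2 * q) / seK α q * (seX P (1 + n + 1) ω - seX P (1 + n) ω) := by
        simp [seL]; ring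
      rw [h1]
      refine (abs_sub _ _).trans (add_le_add ?_ ?_)
      · apply se_bound (fun v : ℤ × ℤ => (v.1 : ℝ)) _ (P.D_range (1 + n) (by omega) ω) <;> simp
      · rw [abs_mul, abs_of_nonneg hga]
        gcongr
        exact seX_diff_abs P _ (by omega) ω)
    (fun n f hf hfb => seL_int P hK (1 + n) (by omega) f hf hfb)
    Set.univ MeasurableSet.univ ε hε N
  simp only [htel] at key
  have hsub : {ω | ε ≤ |seL P (1 + N) ω - seL P 1 ω|} ⊆ 
      Set.univ ∩ {ω | ∃ n, n ≤ N ∧ ε ≤ |seL P (1 + n) ω - seL P 1 ω|} := 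
    fun ω hω => ⟨trivial, N, le_rfl, hω⟩
  refine (mul_le_mul_of_nonneg_left (measureReal_mono hsub) (sq_nonneg _)).trans (key.trans ?_)
  simp

lemma se_pos (P : SEProcess α q Ω) (h : -(1 / 3) ≤ α) (hq1 : q < 1) (n : ℕ) (hn : 1 ≤ n) :
    0 < P.μ.real {ω | P.Δ n ω = ((n : ℤ), 2 * ((n : ℤ) - 1))} := by
  have := P.isProb
  induction n, hn using Nat.le_induction with
  | base => simp [P.init]
  | succ n hn ih =>
    classical
    set S := {ω | P.Δ n ω = ((n : ℤ), 2 * ((n : ℤ) - 1))} with hS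
    set V := {ω | P.Δ (n + 1) ω - P.Δ n ω = (1, 2)} with hV
    have hSm : MeasurableSet[P.F n] S := (P.adapted n hn) (measurableSet_singleton _)
    have hSm' : MeasurableSet S := P.F_le n _ hSm
    have hVm : MeasurableSet V := 
      ((P.D_meas n hn).mono (P.F_le _) le_rfl) (measurableSet_singleton _)
    have key := se_integral P n hn (fun v => if v = (1, 2) then 1 else 0) 
      (S.indicator (fun _ => (1 : ℝ))) (measurable_const.indicator hSm)
      ⟨1, fun ω => by by_cases hω : ω ∈ S <;> simp [hω]⟩ 
      (fun ω => pse α n (P.Δ n ω).1 (P.Δ n ω).2 * (1 - q)) (by intro ω; simp)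
    have hpt : ∀ ω, S.indicator (fun _ => (1 : ℝ)) ω * ((if P.Δ (n + 1) ω - P.Δ n ω = (1, 2) then 1 else 0)
        - pse α n (P.Δ n ω).1 (P.Δ n ω).2 * (1 - q)) = 
        (S ∩ V).indicator (fun _ => (1 : ℝ)) ω - S.indicator (fun _ => 1 - q) ω := by
      intro ω
      by_cases hω : ω ∈ S
      · have hW : seW α n ≠ 0 := by 
          have := seW_ge h n hn
          have hn1 : (1 : ℝ) ≤ n := by exact_mod_cast hn
          linarith
        have hp : pse α n (P.Δ n ω).1 (P.Δ n ω).2 = 1 := by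
          have : seX P n ω = seW α n := by
            have h1 : P.Δ n ω = ((n : ℤ), 2 * ((n : ℤ) - 1)) := hω
            rw [seW_eq α n hn, seX, h1]
            push_cast
            ring
          rw [pse_eq, this, div_self hW]; norm_num
        have hV' : ω ∈ V ↔ P.Δ (n + 1) ω - P.Δ n ω = (1, 2) := Iff.rfl
        rw [hp]
        by_cases hv : P.Δ (n + 1) ω - P.Δ n ω = (1, 2)
        · simp [hω, hV', hv]
        · simp [hω, hV', hv]
      · simp [hω]
    simp only [hpt] at key
    rw [integral_sub ((integrable_const _).indicator (hSm'.inter hVm)) 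
      ((integrable_const _).indicator hSm'), integral_indicator_const _ (hSm'.inter hVm),
      integral_indicator_const _ hSm'] at key
    simp only [smul_eq_mul, mul_one] at key
    have hpos : 0 < P.μ.real (S ∩ V) := by
      have : 0 < P.μ.real S * (1 - q) := mul_pos ih (by linarith)
      linarith
    refine hpos.trans_le (measureReal_mono ?_)
    rintro ω ⟨h1, h2⟩
    have h1' : P.Δ n ω = ((n : ℤ), 2 * ((n : ℤ) - 1)) := h1
    have h2' : P.Δ (n + 1) ω - P.Δ n ω = (1, 2) := h2
    change P.Δ (n + 1) ω = _
    rw [sub_eq_iff_eq_add.mp h2', h1']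
    ext <;> simp <;> ring

end process

section main

variable {α q : ℝ} {Ω : Type} [mΩ : MeasurableSpace Ω]

def seHit (P : SEProcess α q Ω) (A : ℝ) (k : ℕ) : Set Ω :=
  {ω | A * Zse α k * Real.sqrt k < seX P k ω ∧ 
    ∀ j, 1 ≤ j → j < k → ¬ (A * Zse α j * Real.sqrt j < seX P j ω)}

lemma seHit_meas (P : SEProcess α q Ω) (A : ℝ) (k : ℕ) (hk : 1 ≤ k) : 
    MeasurableSet[P.F k] (seHit P A k) := by
  have h0 : ∀ j, 1 ≤ j → j ≤ k → 
      MeasurableSet[P.F k] {ω | A * Zse α j * Real.sqrt j < seX P j ω} := by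
    intro j hj hjk
    exact P.F_mono hjk _ (seX_meas P j hj measurableSet_Ioi)
  have : seHit P A k = {ω | A * Zse α k * Real.sqrt k < seX P k ω} ∩ 
      ⋂ j ∈ Finset.Ico 1 k, {ω | A * Zse α j * Real.sqrt j < seX P j ω}ᶜ := by
    ext ω
    simp [seHit]
  rw [this]
  refine MeasurableSet.inter (h0 k hk le_rfl) ?_
  refine Finset.measurableSet_biInter _ fun j hj => ?_
  rw [Finset.mem_Ico] at hj
  exact (h0 j hj.1 hj.2.le).compl

lemma seHit_unique (P : SEProcess α q Ω) (A : ℝ) (k j : ℕ) (hk : 1 ≤ k) (hj : 1 ≤ j) (ω : Ω)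
    (h1 : ω ∈ seHit P A k) (h2 : ω ∈ seHit P A j) : k = j := by
  rcases lt_trichotomy k j with h | h | h
  · exact absurd h1.1 (h2.2 k hk h)
  · exact h
  · exact absurd h2.1 (h1.2 j hj h)

lemma seHit_exists (P : SEProcess α q Ω) (A : ℝ) (n : ℕ) (hn : 1 ≤ n) (ω : Ω)
    (h : A * Zse α n * Real.sqrt n < seX P n ω) : ∃ k, 1 ≤ k ∧ k ≤ n ∧ ω ∈ seHit P A k := by
  classical
  have hex : ∃ n : ℕ, 1 ≤ n ∧ A * Zse α n * Real.sqrt n < seX P n ω := ⟨n, hn, h⟩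
  refine ⟨Nat.find hex, (Nat.find_spec hex).1, Nat.find_min' hex ⟨hn, h⟩, 
    (Nat.find_spec hex).2, fun j hj hjk hc => Nat.find_min hex hjk ⟨hj, hc⟩⟩

lemma tauHigh_of_hit (P : SEProcess α q Ω) (A : ℝ) (k : ℕ) (hk : 1 ≤ k) (ω : Ω)
    (h : ω ∈ seHit P A k) : tauHigh P A ω = k := by
  apply le_antisymm
  · exact sInf_le ⟨k, rfl, hk, h.1⟩
  · apply le_sInf
    rintro _ ⟨n, rfl, hn, hlt⟩
    by_contra hcon
    have : n < k := by
      have := not_le.mp hcon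
      exact_mod_cast this
    exact h.2 n hn this hlt

lemma exists_hit_of_tauHigh_le (P : SEProcess α q Ω) (A : ℝ) (N : ℕ) (ω : Ω)
    (h : tauHigh P A ω ≤ (N : ℕ∞)) : ∃ k, 1 ≤ k ∧ k ≤ N ∧ ω ∈ seHit P A k := by
  have h1 : tauHigh P A ω < (N : ℕ∞) + 1 := by
    exact (ENat.lt_add_one_iff (ENat.natCast_ne_top N)).mpr h
  obtain ⟨_, ⟨n, rfl, hn, hlt⟩, h2⟩ := sInf_lt_iff.mp h1
  have hnN : n ≤ N := by
    have : n < N + 1 := by exact_mod_cast h2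
    omega
  obtain ⟨k, hk, hkn, hkk⟩ := seHit_exists P A n hn ω hlt
  exact ⟨k, hk, hkn.trans hnN, hkk⟩

lemma lt_tauLow (P : SEProcess α q Ω) (A B : ℝ) (k N : ℕ) (hk : 1 ≤ k) (ω : Ω)
    (h : ω ∈ seHit P A k) 
    (hB : ∀ n, k ≤ n → n ≤ N → B * Zse α n * Real.sqrt n < seX P n ω) : 
    (N : ℕ∞) < tauLow P A B ω := by
  have h1 : (N : ℕ∞) + 1 ≤ tauLow P A B ω := by
    apply le_sInf
    rintro _ ⟨n, rfl, hn, hle⟩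
    rw [tauHigh_of_hit P A k hk ω h] at hn
    have hkn : k < n := by exact_mod_cast hn
    have : N < n := by
      by_contra hcon
      exact absurd hle (not_le.mpr (hB n hkn.le (not_lt.mp hcon)))
    exact_mod_cast this
  exact lt_of_lt_of_le ((ENat.lt_add_one_iff (ENat.natCast_ne_top N)).mpr le_rfl) h1

noncomputable def seLam (α q A : ℝ) (k : ℕ) : ℝ := A * Zse α k * Real.sqrt k / (2 * seA α q k)

lemma seLam_pos {A : ℝ} (h : -(1 / 3) ≤ α) (hq : q ≤ 1 / 16) (hA : 0 < A) (k : ℕ) (hk : 1 ≤ k) : 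
    0 < seLam α q A k := by
  have h1 := Zse_ge h k hk
  have h1' : 0 < Zse α k := by linarith
  have h2 := seA_pos h hq k
  have h3 : 0 < Real.sqrt k := Real.sqrt_pos.mpr (by exact_mod_cast hk)
  unfold seLam
  positivity

def seBad (P : SEProcess α q Ω) (A : ℝ) (k N : ℕ) : Set Ω :=
  seHit P A k ∩ {ω | ∃ n, n ≤ N - k ∧ 
      seLam α q A k ≤ |seX P (k + n) ω / seA α q (k + n) - seX P k ω / seA α q k|}

lemma seBad_le (P : SEProcess α q Ω) (h : -(1 / 3) ≤ α) (hq0 : 0 < q) (hq : q ≤ 1 / 16)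
    {A : ℝ} (hA : 0 < A) (hAq : A ^ 2 * Real.sqrt q = 1) (k N : ℕ) (hk : 1 ≤ k) :
    P.μ.real (seBad P A k N) ≤ 
      3456 * (1 + 2 * |α|) ^ 4 * Real.sqrt q * P.μ.real (seHit P A k) := by
  have key := se_dev P h hq0 hq k hk _ (seHit_meas P A k hk) _ (seLam_pos h hq hA k hk) (N - k)
  change _ * P.μ.real (seBad P A k N) ≤ _ at key
  have ha := seA_pos h hq k
  have hZ := Zse_ge h k hk
  have hk1 : (1 : ℝ) ≤ k := by exact_mod_cast hk
  set b := P.μ.real (seBad P A k N)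
  set t := P.μ.real (seHit P A k)
  have hb : 0 ≤ b := measureReal_nonneg
  have ht : 0 ≤ t := measureReal_nonneg
  set m := 1 + 2 * |α|
  have e1 : seLam α q A k ^ 2 = A ^ 2 * Zse α k ^ 2 * k / (4 * seA α q k ^ 2) := by
    unfold seLam
    rw [div_pow, mul_pow, mul_pow, Real.sq_sqrt (by linarith)]
    ring
  rw [e1, div_mul_eq_mul_div, div_le_iff₀ (by positivity)] at key
  have e2 : t * ((4 * m ^ 2) ^ 2 * (2 * ((k + 2) / seA α q k ^ 2))) * (4 * seA α q k ^ 2) = 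
      128 * m ^ 4 * (k + 2) * t := by field_simp; ring
  rw [e2] at key
  have h1 : A ^ 2 * (1 / 3) ^ 2 * k * b ≤ A ^ 2 * Zse α k ^ 2 * k * b := by gcongr
  have h2 : 128 * m ^ 4 * (k + 2) * t ≤ 128 * m ^ 4 * (3 * k) * t := by gcongr; linarith
  have h3 : (A ^ 2 * b) * k ≤ (3456 * m ^ 4 * t) * k := by nlinarith
  have h4 := le_of_mul_le_mul_right h3 (by linarith)
  have h5 := mul_le_mul_of_nonneg_right h4 (Real.sqrt_nonneg q)
  calc b = A ^ 2 * b * Real.sqrt q := by rw [mul_right_comm, hAq, one_mul]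
    _ ≤ _ := h5
    _ = _ := by ring

lemma se_good (P : SEProcess α q Ω) (h : -(1 / 3) ≤ α) (hq : q ≤ 1 / 16)
    {A : ℝ} (k N n : ℕ) (hkn : k ≤ n) (hnN : n ≤ N) (ω : Ω)
    (h1 : ω ∈ seHit P A k) (h2 : ω ∉ seBad P A k N) : seLam α q A k * seA α q n < seX P n ω := by
  obtain ⟨j, rfl⟩ := Nat.exists_eq_add_of_le hkn
  have h3 : |seX P (k + j) ω / seA α q (k + j) - seX P k ω / seA α q k| < seLam α q A k := by
    by_contra hcon
    exact h2 ⟨h1, j, by omega, not_lt.mp hcon⟩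
  have ha := seA_pos h hq k
  have ha' := seA_pos h hq (k + j)
  have h4 : 2 * seLam α q A k < seX P k ω / seA α q k := by
    rw [lt_div_iff₀ ha]
    have : 2 * seLam α q A k * seA α q k = A * Zse α k * Real.sqrt k := by
      unfold seLam; field_simp
    rw [this]
    exact h1.1
  have h5 := (abs_lt.mp h3).1
  rw [← lt_div_iff₀ ha']
  linarith

lemma seLam_ge (h : -(1 / 3) ≤ α) (hq : q ≤ 1 / 16)
    {A : ℝ} (hA : 24 * (1 + 2 * |α|) ≤ A) (k n : ℕ) (hk : 1 ≤ k) (hkn : k ≤ n) :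
    2 * Zse α n * Real.sqrt n ≤ seLam α q A k * seA α q n := by
  have ha := seA_pos h hq k
  have ha' := seA_pos h hq n
  have hZ := Zse_ge h k hk
  have hZ' := Zse_le α n (hk.trans hkn)
  have hm := seA_mono h hq k n hk hkn
  have h1 : seA α q k * Real.sqrt n ≤ 2 * Real.sqrt k * seA α q n := by
    apply abs_le_of_sq_le_sq' _ (by positivity) |>.2
    rw [mul_pow, mul_pow, mul_pow, Real.sq_sqrt (by positivity), Real.sq_sqrt (by positivity)]
    have : 0 ≤ (k : ℝ) * seA α q n ^ 2 := by positivity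
    nlinarith
  have hA0 : 0 ≤ A := by have := abs_nonneg α; linarith
  have e : seLam α q A k * seA α q n = A * Zse α k * (Real.sqrt k * seA α q n) / (2 * seA α q k) := by
    unfold seLam; ring
  rw [e, le_div_iff₀ (by positivity)]
  have h2 : A * (1 / 3) * (Real.sqrt k * seA α q n) ≤ A * Zse α k * (Real.sqrt k * seA α q n) := by
    gcongr
  refine le_trans ?_ h2
  have h3 : 2 * Zse α n * Real.sqrt n * (2 * seA α q k) ≤ 
      2 * (1 + 2 * |α|) * Real.sqrt n * (2 * seA α q k) := by gcongr
  have h4 : 24 * (1 + 2 * |α|) * (1 / 3) * (Real.sqrt k * seA α q n) ≤ 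
      A * (1 / 3) * (Real.sqrt k * seA α q n) := by gcongr
  have h5 : (4 * (1 + 2 * |α|)) * (seA α q k * Real.sqrt n) ≤ 
      (4 * (1 + 2 * |α|)) * (2 * Real.sqrt k * seA α q n) := by gcongr
  nlinarith

lemma seT_small (P : SEProcess α q Ω) (h : -(1 / 3) ≤ α) (hq0 : 0 < q) (hq : q ≤ 1 / 16) 
    (l δ : ℝ) (hl : 0 < l) (hδ : 0 < δ) : ∀ᶠ N : ℕ in atTop, 2 ≤ l * seA α q N ∧ 
      P.μ.real {ω | (1 - 2 * q) / seK α q * l * seA α q N / 2 ≤ |seL P N ω - seL P 1 ω|} ≤ δ := by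
  have hK := seK_pos h hq
  have hga : 0 < (1 - 2 * q) / seK α q := div_pos (by linarith) hK
  set γ := (1 - 2 * q) / seK α q with hγ
  set C := (1 + γ * (1 + 2 * |α|)) ^ 2 with hC
  filter_upwards [seA_large h hq (4 / l ^ 2), seA_large h hq (4 * C / (δ * γ ^ 2 * l ^ 2)),
    eventually_ge_atTop 1] with N h1 h2 hN
  have hN1 : (1 : ℝ) ≤ N := by exact_mod_cast hN
  have ha := seA_pos h hq N
  constructor
  · apply abs_le_of_sq_le_sq' _ (by positivity) |>.2
    have h3 : 4 / l ^ 2 * 1 ≤ 4 / l ^ 2 * N := by gcongr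
    have h4 : 4 / l ^ 2 ≤ seA α q N ^ 2 := by linarith
    rw [div_le_iff₀ (by positivity)] at h4
    nlinarith
  · obtain ⟨M, rfl⟩ := Nat.exists_eq_add_of_le hN
    have key := seL_dev P h hq0 hq (γ * l * seA α q (1 + M) / 2) (by positivity) M
    rw [← hγ, ← hC] at key
    rw [div_mul_eq_mul_div, div_le_iff₀ (by positivity)] at h2
    have hM : (M : ℝ) * C ≤ ((1 + M : ℕ) : ℝ) * C := by
      have : 0 ≤ C := sq_nonneg _
      push_cast
      nlinarith
    have hpos : 0 < (γ * l * seA α q (1 + M) / 2) ^ 2 := by positivity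
    refine le_of_mul_le_mul_left (key.trans ?_) hpos
    nlinarith

end main

lemma se_main {α q : ℝ} {Ω : Type} [mΩ : MeasurableSpace Ω] (P : SEProcess α q Ω)
    (h : -(1 / 3) ≤ α) (hq0 : 0 < q) (hq : q ≤ 1 / 16)
    {A : ℝ} (hA : 24 * (1 + 2 * |α|) ≤ A) (hAq : A ^ 2 * Real.sqrt q = 1)
    (C : ℝ) (hC : C = 3456 * (1 + 2 * |α|) ^ 4) (hCq : C * Real.sqrt q ≤ 1 / 2) :
    ∀ᶠ N : ℕ in atTop, 1 - 2 * (C + 1) * Real.sqrt q ≤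
      ((ProbabilityTheory.cond P.μ {ω | tauHigh P A ω ≤ (N : ℕ∞) ∧ (N : ℕ∞) < tauLow P A 2 ω})
        {ω | 0 < (P.Δ N ω).1}).toReal := by
  have := P.isProb
  have hA0 : 0 < A := by have := abs_nonneg α; linarith
  have hC0 : 0 ≤ C := by rw [hC]; positivity
  have hsq : 0 < Real.sqrt q := Real.sqrt_pos.mpr hq0
  have hK := seK_pos h hq
  have hga : 0 < (1 - 2 * q) / seK α q := div_pos (by linarith) hK
  set hs : ℕ → ℝ := fun N => ∑ k ∈ Finset.Icc 1 N, P.μ.real (seHit P A k) with hhs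
  set H : ℕ → Set Ω := fun N => ⋃ k ∈ Finset.Icc 1 N, seHit P A k with hH
  have hH_eq : ∀ N, P.μ.real (H N) = hs N := by
    intro N
    apply measureReal_biUnion_finset
    · intro i hi j hj hij
      rw [Finset.mem_coe, Finset.mem_Icc] at hi hj
      rw [Function.onFun, Set.disjoint_left]
      intro ω h1 h2
      exact hij (seHit_unique P A i j hi.1 hj.1 ω h1 h2)
    · intro k hk
      exact P.F_le _ _ (seHit_meas P A k (Finset.mem_Icc.mp hk).1)
    · intro k _; exact measure_ne_top _ _
  have hs_mono : Monotone hs := by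
    intro a b hab
    apply Finset.sum_le_sum_of_subset_of_nonneg
    · exact Finset.Icc_subset_Icc le_rfl hab
    · intros; exact measureReal_nonneg
  have hs_bdd : BddAbove (Set.range hs) := by
    refine ⟨1, ?_⟩
    rintro _ ⟨N, rfl⟩
    rw [← hH_eq]
    exact measureReal_le_one
  -- positivity
  obtain ⟨n0, hn0, hn0pos⟩ : ∃ n0, 1 ≤ n0 ∧ 0 < hs n0 := by
    obtain ⟨n0, hn0⟩ := exists_nat_gt (A ^ 2)
    have hn0' : (0 : ℝ) < n0 := lt_of_le_of_lt (sq_nonneg A) hn0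
    have hn1 : 1 ≤ n0 := by
      have : 0 < n0 := by exact_mod_cast hn0'
      omega
    refine ⟨n0, hn1, ?_⟩
    rw [← hH_eq]
    refine (se_pos P h (by linarith) n0 hn1).trans_le (measureReal_mono ?_ (measure_ne_top _ _))
    intro ω hω
    have h1 : P.Δ n0 ω = ((n0 : ℤ), 2 * ((n0 : ℤ) - 1)) := hω
    have hX : seX P n0 ω = seW α n0 := by
      rw [seW_eq α n0 hn1, seX, h1]
      push_cast
      ring
    have hlt : A * Zse α n0 * Real.sqrt n0 < seX P n0 ω := by
      rw [hX, seW]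
      have hZ := Zse_ge h n0 hn1
      have hA1 : A < Real.sqrt n0 := Real.lt_sqrt_of_sq_lt hn0
      have hs1 : Real.sqrt n0 * Real.sqrt n0 = n0 := Real.mul_self_sqrt hn0'.le
      have hspos : 0 < Real.sqrt n0 := Real.sqrt_pos.mpr hn0'
      calc A * Zse α n0 * Real.sqrt n0 < Real.sqrt n0 * Zse α n0 * Real.sqrt n0 := by
            have : 0 < Zse α n0 := by linarith
            gcongr
        _ = _ := by rw [mul_right_comm, hs1, mul_comm]
    obtain ⟨k, hk, hkn, hkk⟩ := seHit_exists P A n0 hn1 ω hlt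
    simp only [hH, Set.mem_iUnion]
    exact ⟨k, Finset.mem_Icc.mpr ⟨hk, hkn⟩, hkk⟩
  set δ := Real.sqrt q * hs n0 / 2 with hδ
  have hδ0 : 0 < δ := by positivity
  obtain ⟨K, hK0, hKd⟩ : ∃ K, n0 ≤ K ∧ ∀ N, hs N ≤ hs K + δ := by
    obtain ⟨K, hK⟩ := exists_lt_of_lt_ciSup (sub_lt_self (⨆ N, hs N) hδ0)
    refine ⟨max K n0, le_max_right _ _, fun N => ?_⟩
    have h1 := le_ciSup hs_bdd N
    have h2 := hs_mono (le_max_left K n0)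
    linarith
  obtain ⟨l, hl0, hl⟩ : ∃ l, 0 < l ∧ ∀ k ∈ Finset.Icc 1 K, l ≤ seLam α q A k := by
    obtain ⟨k, hk, hmin⟩ := Finset.exists_min_image (Finset.Icc 1 K) (seLam α q A)
      ⟨1, Finset.mem_Icc.mpr ⟨le_rfl, hn0.trans hK0⟩⟩
    exact ⟨_, seLam_pos h hq hA0 k (Finset.mem_Icc.mp hk).1, hmin⟩
  filter_upwards [seT_small P h hq0 hq l δ hl0 hδ0, eventually_ge_atTop K] with N hT hKN
  obtain ⟨hT1, hT2⟩ := hT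
  set T := {ω | (1 - 2 * q) / seK α q * l * seA α q N / 2 ≤ |seL P N ω - seL P 1 ω|} with hTdef
  set E := {ω | tauHigh P A ω ≤ (N : ℕ∞) ∧ (N : ℕ∞) < tauLow P A 2 ω} with hE
  set G := {ω | 0 < (P.Δ N ω).1} with hG
  have hN1 : 1 ≤ N := by omega
  have hGm : MeasurableSet G := by
    have : Measurable (fun ω => (P.Δ N ω).1) := 
      measurable_fst.comp ((P.adapted N hN1).mono (P.F_le N) le_rfl)
    exact this measurableSet_Ioi
  set Bad : Set Ω := ⋃ k ∈ Finset.Icc 1 N, seBad P A k N with hBad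
  have hBadle : P.μ.real Bad ≤ C * Real.sqrt q * hs N := by
    refine (measureReal_biUnion_finset_le _ _).trans ?_
    rw [hhs, Finset.mul_sum]
    apply Finset.sum_le_sum
    intro k hk
    rw [hC]
    exact seBad_le P h hq0 hq hA0 hAq k N (Finset.mem_Icc.mp hk).1
  have hgood : ∀ ω k, 1 ≤ k → k ≤ N → ω ∈ seHit P A k → ω ∉ Bad → ω ∉ seBad P A k N := by
    intro ω k hk hkN _ hb hc
    apply hb
    simp only [hBad, Set.mem_iUnion]
    exact ⟨k, Finset.mem_Icc.mpr ⟨hk, hkN⟩, hc⟩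
  have hHE : H N ⊆ E ∪ Bad := by
    intro ω hω
    simp only [hH, Set.mem_iUnion] at hω
    obtain ⟨k, hk, hkk⟩ := hω
    obtain ⟨hk1, hkN⟩ := Finset.mem_Icc.mp hk
    by_cases hb : ω ∈ Bad
    · exact Or.inr hb
    · left
      have hb' := hgood ω k hk1 hkN hkk hb
      refine ⟨?_, ?_⟩
      · rw [tauHigh_of_hit P A k hk1 ω hkk]
        exact_mod_cast hkN
      · apply lt_tauLow P A 2 k N hk1 ω hkk
        intro n hkn hnN
        exact lt_of_le_of_lt (seLam_ge h hq hA k n hk1 hkn) (se_good P h hq k N n hkn hnN ω hkk hb')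
  have hEG : E \ G ⊆ Bad ∪ ((⋃ k ∈ Finset.Ioc K N, seHit P A k) ∪ T) := by
    rintro ω ⟨⟨hω1, _⟩, hω2⟩
    obtain ⟨k, hk1, hkN, hkk⟩ := exists_hit_of_tauHigh_le P A N ω hω1
    by_cases hb : ω ∈ Bad
    · exact Or.inl hb
    · right
      rcases Nat.lt_or_ge K k with hkK | hkK
      · left
        simp only [Set.mem_iUnion]
        exact ⟨k, Finset.mem_Ioc.mpr ⟨hkK, hkN⟩, hkk⟩
      · right
        have hb' := hgood ω k hk1 hkN hkk hb
        have h1 := se_good P h hq k N N hkN le_rfl ω hkk hb'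
        have h2 := hl k (Finset.mem_Icc.mpr ⟨hk1, hkK⟩)
        have ha := seA_pos h hq N
        have h3 : l * seA α q N ≤ seX P N ω := 
          (mul_le_mul_of_nonneg_right h2 ha.le).trans h1.le
        have h4 : ((P.Δ N ω).1 : ℝ) ≤ 0 := by
          have : ¬ (0 < (P.Δ N ω).1) := hω2
          exact_mod_cast not_lt.mp this
        have hL1 : seL P 1 ω = 1 - (1 - 2 * q) / seK α q := by
          rw [seL, seX_one, P.init]; simp
        change _ ≤ |seL P N ω - seL P 1 ω|
        rw [hL1, seL]
        generalize (1 - 2 * q) / seK α q = γ at hga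
        have h5 := mul_le_mul_of_nonneg_left h3 hga.le
        have h6 := mul_le_mul_of_nonneg_left hT1 hga.le
        refine le_trans ?_ (neg_le_abs _)
        linarith
  have hIoc : P.μ.real (⋃ k ∈ Finset.Ioc K N, seHit P A k) ≤ δ := by
    refine (measureReal_biUnion_finset_le _ _).trans ?_
    have h1 := hKd N
    have h2 : hs N = hs K + ∑ k ∈ Finset.Ioc K N, P.μ.real (seHit P A k) := by
      rw [hhs]
      have e1 : ∀ n, Finset.Icc 1 n = Finset.Ioc 0 n := by intro n; rfl
      simp only [e1]
      rw [Finset.sum_Ioc_consecutive _ (Nat.zero_le K) hKN]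
    linarith
  have hy : P.μ.real (E \ G) ≤ C * Real.sqrt q * hs N + (δ + δ) := by
    refine (measureReal_mono hEG (measure_ne_top _ _)).trans ((measureReal_union_le _ _).trans (add_le_add hBadle ?_))
    exact (measureReal_union_le _ _).trans (add_le_add hIoc hT2)
  have hh : hs N ≤ P.μ.real E + C * Real.sqrt q * hs N := by
    rw [← hH_eq] at hBadle ⊢
    exact (measureReal_mono hHE (measure_ne_top _ _)).trans ((measureReal_union_le _ _).trans (by linarith))
  have hN0 : hs n0 ≤ hs N := hs_mono (hK0.trans hKN)
  have he : hs N / 2 ≤ P.μ.real E := by nlinarith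
  have hxy : P.μ.real E ≤ P.μ.real (E ∩ G) + P.μ.real (E \ G) := by
    refine le_trans (measureReal_mono ?_ (measure_ne_top _ _)) (measureReal_union_le _ _)
    rw [Set.inter_union_sdiff]
  rw [ProbabilityTheory.cond_apply' hGm, ENNReal.toReal_mul, ENNReal.toReal_inv]
  change _ ≤ (P.μ.real E)⁻¹ * P.μ.real (E ∩ G)
  have hepos : 0 < P.μ.real E := by linarith
  rw [inv_mul_eq_div, le_div_iff₀ hepos]
  have h7 : δ + δ ≤ Real.sqrt q * hs N := by
    rw [hδ]; nlinarith
  have h8 : (C + 1) * Real.sqrt q * hs N ≤ (C + 1) * Real.sqrt q * (2 * P.μ.real E) := by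
    gcongr
    linarith
  nlinarith

/-- For shape exchangeable trees there are `B > 1` and `c_{α,1} > 0` such that for every
`q ∈ (0,1]`, with `A = q^(-1/4)`,
`liminf_N μ(Δ₁(N) > 0 | τ_high(A) ≤ N, τ_low(B) > N) ≥ 1 - c_{α,1} √q`. -/
theorem se_conditional_majority_bound (α : ℝ) (hα : α ∈ seAllowed) :
    ∃ B c : ℝ, 1 < B ∧ 0 < c ∧
      ∀ q : ℝ, 0 < q → q ≤ 1 →
        ∀ (Ω : Type) [MeasurableSpace Ω] (P : SEProcess α q Ω),
          1 - c * Real.sqrt q ≤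
            Filter.liminf (fun N : ℕ =>
              ((ProbabilityTheory.cond P.μ
                  {ω | tauHigh P (q ^ (-(1 : ℝ) / 4)) ω ≤ (N : ℕ∞) ∧
                    (N : ℕ∞) < tauLow P (q ^ (-(1 : ℝ) / 4)) B ω})
                {ω | 0 < (P.Δ N ω).1}).toReal)
              Filter.atTop := by
  have h := seAllowed_ge hα
  set m := 1 + 2 * |α| with hm
  have hm1 : 1 ≤ m := by have := abs_nonneg α; linarith
  set C := 3456 * m ^ 4 with hC
  have hC0 : 0 ≤ C := by positivity
  refine ⟨2, 2 * (C + 1) + 4 + (24 * m) ^ 2, by norm_num, by positivity, ?_⟩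
  intro q hq0 hq1 Ω _ P
  have hsq : 0 < Real.sqrt q := Real.sqrt_pos.mpr hq0
  apply le_liminf_of_le
  · refine isCoboundedUnder_ge_of_le (x := 1) atTop fun N => ?_
    exact ENNReal.toReal_le_of_le_ofReal zero_le_one (by simpa using prob_le_one)
  · rcases le_or_gt 1 ((2 * (C + 1) + 4 + (24 * m) ^ 2) * Real.sqrt q) with hbig | hsmall
    · exact Eventually.of_forall fun N => le_trans (by linarith) ENNReal.toReal_nonneg
    · have hCs : 0 ≤ C * Real.sqrt q := by positivity
      have hms : 0 ≤ (24 * m) ^ 2 * Real.sqrt q := by positivity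
      have h1 : Real.sqrt q ≤ 1 / 4 := by nlinarith
      have hq : q ≤ 1 / 16 := by
        have := Real.sq_sqrt hq0.le
        nlinarith
      have hApos : 0 < q ^ (-(1 : ℝ) / 4) := Real.rpow_pos_of_pos hq0 _
      have hAq : (q ^ (-(1 : ℝ) / 4)) ^ 2 * Real.sqrt q = 1 := by
        rw [← Real.rpow_natCast, ← Real.rpow_mul hq0.le, Real.sqrt_eq_rpow, ← Real.rpow_add hq0]
        norm_num
      have hA : 24 * m ≤ q ^ (-(1 : ℝ) / 4) := by
        apply (abs_le_of_sq_le_sq' _ hApos.le).2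
        refine le_of_mul_le_mul_right ?_ hsq
        rw [hAq]
        nlinarith
      have key := se_main P h hq0 hq hA hAq C hC (by nlinarith)
      filter_upwards [key] with N hN
      refine le_trans ?_ hN
      nlinarith
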